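/- Let b = 1.15, a = b·(3^{1/3} − 1)^{−1}, and P₃(X) = X + X² + (2/3)X³. Then for every real λ₁ with 0.6 ≤ λ₁ ≤ 0.85, one has P₃((a + λ₁)/a) − P₃(1) − 2·P₃((a + λ₁)/(a + b)) + (3/4)·(a + λ₁) < −0.005. -/

import Mathlib

noncomputable def bconst : ℝ := 1.15

noncomputable def aconst : ℝ := bconst * ((3 : ℝ) ^ ((1 : ℝ) / 3) - 1)⁻¹

noncomputable def P₃ (X : ℝ) : ℝ := X + X ^ 2 + (2 / 3) * X ^ 3

noncomputable def S (X : ℝ) : ℝ :=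
  P₃ (X / aconst) - P₃ 1 - 2 * P₃ (X / (aconst + bconst)) + (3 / 4) * X

theorem three_rpow_third_pow_three : ((3 : ℝ) ^ ((1 : ℝ) / 3)) ^ 3 = 3 := by
  rw [← Real.rpow_natCast, ← Real.rpow_mul (by norm_num)]
  norm_num


/-- For every `λ₁ ∈ [0.6, 0.85]`, the key expression is less than `−0.005`. -/
theorem key_expression_lt_neg_point_005 :
    ∀ lam : ℝ, 0.6 ≤ lam → lam ≤ 0.85 →
      P₃ ((aconst + lam) / aconst) - P₃ 1
        - 2 * P₃ ((aconst + lam) / (aconst + bconst))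
        + (3 / 4) * (aconst + lam) < -0.005 := by
  intro l hl1 hl2
  obtain ⟨c, hc⟩ : ∃ c : ℝ, c = (3 : ℝ) ^ ((1 : ℝ) / 3) := ⟨_, rfl⟩
  have hc3 : c ^ 3 = 3 := hc ▸ three_rpow_third_pow_three
  have hc0 : 0 ≤ c := hc ▸ by positivity
  have hlo : 1.442249 < c := lt_of_pow_lt_pow_left₀ 3 hc0 (by rw [hc3]; norm_num)
  have hhi : c < 1.44225 := lt_of_pow_lt_pow_left₀ 3 (by norm_num) (by rw [hc3]; norm_num)
  have ha : aconst = 1.15 * (c - 1)⁻¹ := by rw [aconst, bconst, hc]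
  have hne : c - 1 ≠ 0 := by linarith
  have ha' : aconst = 1.15 * ((c ^ 2 + c + 1) / 2) := by
    rw [ha]
    field_simp
    linear_combination -hc3
  have hapos : 0 < aconst := by rw [ha']; positivity
  have hab : aconst + bconst = aconst * c := by
    rw [ha, bconst]
    field_simp
    ring
  obtain ⟨u, hu⟩ : ∃ u : ℝ, u = 1 + l * (c - 1) / 1.15 := ⟨_, rfl⟩
  have hau : aconst + l = aconst * u := by
    rw [hu, ha]
    field_simp
  have hdiv : aconst * u / (aconst * c) = u * c ^ 2 / 3 := by
    have : c ≠ 0 := by linarith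
    field_simp
    linear_combination -u * hc3
  have hu0 : 0 ≤ u := by
    rw [hu]
    have : 0 ≤ l * (c - 1) := mul_nonneg (by linarith) (by linarith)
    positivity
  have hu1 : u ≤ 1.326881 := by
    have : l * (c - 1) ≤ 0.85 * 0.44225 :=
      mul_le_mul hl2 (by linarith) (by linarith) (by norm_num)
    have hq : l * (c - 1) / 1.15 ≤ 0.326881 := by
      rw [div_le_iff₀ (by norm_num)]
      exact this.trans (by norm_num)
    rw [hu]
    linarith
  rw [hab, hau, hdiv, mul_div_cancel_left₀ u hapos.ne', ha']
  have key : P₃ u - P₃ 1 - 2 * P₃ (u * c ^ 2 / 3) + 3 / 4 * (1.15 * ((c ^ 2 + c + 1) / 2) * u)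
      = (1 - 2 * c ^ 2 / 3 + 3 / 4 * (1.15 * ((c ^ 2 + c + 1) / 2))) * u
        + (1 - 2 * c / 3) * u ^ 2 + 2 / 9 * u ^ 3 - 8 / 3 := by
    unfold P₃
    linear_combination (-2 * u ^ 2 * c / 9 - 4 / 81 * u ^ 3 * (c ^ 3 + 3)) * hc3
  rw [key]
  have hA : 1 - 2 * c ^ 2 / 3 + 3 / 4 * (1.15 * ((c ^ 2 + c + 1) / 2)) ≤ 1.563547 := by
    nlinarith
  have hB : 1 - 2 * c / 3 ≤ 0.038501 := by linarith
  have hu2 : u ^ 2 ≤ 1.326881 ^ 2 := pow_le_pow_left₀ hu0 hu1 2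
  have hu3 : u ^ 3 ≤ 1.326881 ^ 3 := pow_le_pow_left₀ hu0 hu1 3
  have h1 := mul_le_mul hA hu1 hu0 (by norm_num)
  have h2 := mul_le_mul hB hu2 (by positivity) (by norm_num)
  linarith
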